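/- Let k be an algebraically closed field, let g_1,…,g_r, g ∈ k[x_1,…,x_n], and let I_W = ⟨g_1,…,g_r⟩. Suppose that for every point p ∈ kⁿ with g_1(p) = ⋯ = g_r(p) = 0 and g(p) ≠ 0, the localization of k[x_1,…,x_n]/I_W at m_p/I_W is a regular local ring of Krull dimension n − r. Then g lies in the radical of the ideal I_W + M_r, where M_r is the ideal generated by all r × r minors of the Jacobian matrix (∂g_l/∂x_j). In particular, the complements of the vanishing loci of these minors cover W ∩ D(g). -/

import Mathlib

open MvPolynomial

/-- The maximal ideal of `k[x_1,…,x_n]` of polynomials vanishing at the point `p`,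
i.e. the kernel of the evaluation map at `p` (equivalently `⟨x_1 - p_1, …, x_n - p_n⟩`). -/
noncomputable def mP {k : Type} [Field k] {n : ℕ} (p : Fin n → k) :
    Ideal (MvPolynomial (Fin n) k) :=
  RingHom.ker (eval p)

theorem mP_isMaximal {k : Type} [Field k] {n : ℕ} (p : Fin n → k) : (mP p).IsMaximal :=
  RingHom.ker_isMaximal_of_surjective _ (fun x => ⟨C x, eval_C x⟩)

/-- For `I ≤ m_p`, the ideal `m_p/I` of the quotient ring is maximal. -/
theorem qP_isMaximal {k : Type} [Field k] {n : ℕ} (p : Fin n → k)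
    (I : Ideal (MvPolynomial (Fin n) k)) (hI : I ≤ mP p) :
    (Ideal.map (Ideal.Quotient.mk I) (mP p)).IsMaximal := by
  rcases Ideal.map_eq_top_or_isMaximal_of_surjective (Ideal.Quotient.mk I)
      Ideal.Quotient.mk_surjective (mP_isMaximal p) with h | h
  · exfalso
    have h2 := congrArg (Ideal.comap (Ideal.Quotient.mk I)) h
    rw [Ideal.comap_map_of_surjective _ Ideal.Quotient.mk_surjective, Ideal.comap_top] at h2
    have hk : Ideal.comap (Ideal.Quotient.mk I) ⊥ = I := by
      simpa [RingHom.ker] using Ideal.mk_ker (I := I)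
    rw [hk, sup_eq_left.mpr hI] at h2
    exact (mP_isMaximal p).ne_top h2
  · exact h

/-- A local ring is regular if its Krull dimension equals the dimension of
its cotangent space `m/m²` over the residue field. -/
def IsRegularLocal (R : Type) [CommRing R] [IsLocalRing R] : Prop :=
  ringKrullDim R =
    (Module.finrank (IsLocalRing.ResidueField R) (IsLocalRing.CotangentSpace R) : WithBot ℕ∞)

/-- A matrix with linearly independent rows has a nonzero maximal minor. -/
theorem exists_minor_ne_zero {k : Type} [Field k] {n r : ℕ} (M : Matrix (Fin r) (Fin n) k)
    (h : LinearIndependent k M.row) :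
    ∃ S : Fin r ↪ Fin n, (M.submatrix id S).det ≠ 0 := by
  obtain ⟨κ, a, ha, hspan, hli⟩ := exists_linearIndependent' k M.col
  have hfin : Finite κ := Finite.of_injective a ha
  have := Fintype.ofFinite κ
  have hcard : Fintype.card κ = r := by
    have h1 := finrank_span_eq_card hli
    rw [hspan, ← Matrix.rank_eq_finrank_span_cols, h.rank_matrix, Fintype.card_fin] at h1
    exact h1.symm
  let e : Fin r ≃ κ := (Fintype.equivFinOfCardEq hcard).symm
  refine ⟨⟨a ∘ e, ha.comp e.injective⟩, ?_⟩
  have h2 : LinearIndependent k (M.submatrix id (a ∘ e)).col := hli.comp e e.injective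
  rw [Matrix.linearIndependent_cols_iff_isUnit, Matrix.isUnit_iff_isUnit_det] at h2
  exact h2.ne_zero

/-- The gradient at `p`. -/
noncomputable def gradAt {k : Type} [Field k] {n : ℕ} (p : Fin n → k)
    (f : MvPolynomial (Fin n) k) : Fin n → k := fun j => eval p (pderiv j f)

theorem gradAt_mem_span {k : Type} [Field k] {n : ℕ} (p : Fin n → k) {ι : Type}
    (F : ι → MvPolynomial (Fin n) k) (hF : ∀ i, eval p (F i) = 0)
    (h : MvPolynomial (Fin n) k) (hh : h ∈ Ideal.span (Set.range F)) :
    eval p h = 0 ∧ gradAt p h ∈ Submodule.span k (Set.range fun i => gradAt p (F i)) := by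
  induction hh using Submodule.span_induction with
  | mem x hx =>
    obtain ⟨i, rfl⟩ := hx
    exact ⟨hF i, Submodule.subset_span ⟨i, rfl⟩⟩
  | zero =>
    refine ⟨map_zero _, ?_⟩
    have : gradAt p (0 : MvPolynomial (Fin n) k) = 0 := by ext j; simp [gradAt]
    rw [this]; exact Submodule.zero_mem _
  | add x y _ _ hx hy =>
    refine ⟨by rw [map_add, hx.1, hy.1, add_zero], ?_⟩
    have : gradAt p (x + y) = gradAt p x + gradAt p y := by ext j; simp [gradAt]
    rw [this]; exact Submodule.add_mem _ hx.2 hy.2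
  | smul a x _ hx =>
    refine ⟨by rw [smul_eq_mul, map_mul, hx.1, mul_zero], ?_⟩
    have : gradAt p (a • x) = eval p a • gradAt p x := by
      ext j; simp [gradAt, hx.1]
    rw [this]; exact Submodule.smul_mem _ _ hx.2

/-- Generators of the maximal ideal of a localization can be taken from the base ring. -/
theorem exists_gens {B : Type} [CommRing B] [IsNoetherianRing B] (P : Ideal B) [P.IsPrime] (d : ℕ)
    (hd : Module.finrank (IsLocalRing.ResidueField (Localization.AtPrime P))
      (IsLocalRing.CotangentSpace (Localization.AtPrime P)) = d) :
    ∃ f : Fin d → B, (∀ j, f j ∈ P) ∧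
      ∀ b ∈ P, ∃ t, t ∉ P ∧ t * b ∈ Ideal.span (Set.range f) := by
  let R := Localization.AtPrime P
  have : IsNoetherianRing R := IsLocalization.isNoetherianRing P.primeCompl R inferInstance
  obtain ⟨s, hs, hspan⟩ := Submodule.FG.exists_span_finset_card_eq_spanFinrank
    (IsNoetherian.noetherian (IsLocalRing.maximalIdeal R))
  rw [IsLocalRing.spanFinrank_maximalIdeal_eq_finrank_cotangentSpace, hd] at hs
  let e : Fin d ≃ s := (s.equivFinOfCardEq hs).symm
  have hsurj : ∀ j, ∃ (y : B) (t : P.primeCompl), IsLocalization.mk' R y t = (e j : R) :=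
    fun j => by
      obtain ⟨⟨y, t⟩, h⟩ := IsLocalization.mk'_surjective P.primeCompl (e j : R)
      exact ⟨y, t, h⟩
  choose y t ht using hsurj
  have hmem : ∀ j, (e j : R) ∈ IsLocalRing.maximalIdeal R := fun j => by
    rw [← hspan]; exact Submodule.subset_span (e j).2
  have hfP : ∀ j, y j ∈ P := fun j => by
    have := hmem j
    rw [← ht j] at this
    exact (IsLocalization.AtPrime.mk'_mem_maximal_iff R P _ _).mp this
  refine ⟨y, hfP, fun b hb => ?_⟩
  have hb1 : algebraMap B R b ∈ IsLocalRing.maximalIdeal R :=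
    (IsLocalization.AtPrime.to_map_mem_maximal_iff R P b).mpr hb
  have hle : IsLocalRing.maximalIdeal R ≤ (Ideal.span (Set.range y)).map (algebraMap B R) := by
    rw [← hspan]
    refine Submodule.span_le.mpr fun z hz => ?_
    obtain ⟨j, hj⟩ := e.surjective ⟨z, hz⟩
    have hz2 : z = (e j : R) := by rw [hj]
    rw [hz2, ← ht j, IsLocalization.mk'_eq_mul_mk'_one]
    exact Ideal.mul_mem_right _ _ (Ideal.mem_map_of_mem _ (Ideal.subset_span ⟨j, rfl⟩))
  have hb2 := hle hb1
  rw [IsLocalization.algebraMap_mem_map_algebraMap_iff P.primeCompl] at hb2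
  obtain ⟨m, hm, h⟩ := hb2
  exact ⟨m, hm, h⟩

theorem jacobian_rows_independent {k : Type} [Field k] {n r : ℕ} (hr : r ≤ n)
    (g : Fin r → MvPolynomial (Fin n) k) (p : Fin n → k) (h0 : ∀ l, eval p (g l) = 0)
    (hle : Ideal.span (Set.range g) ≤ mP p)
    (hP : (Ideal.map (Ideal.Quotient.mk (Ideal.span (Set.range g))) (mP p)).IsPrime)
    (hd : Module.finrank
      (IsLocalRing.ResidueField (Localization.AtPrime
        (Ideal.map (Ideal.Quotient.mk (Ideal.span (Set.range g))) (mP p))))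
      (IsLocalRing.CotangentSpace (Localization.AtPrime
        (Ideal.map (Ideal.Quotient.mk (Ideal.span (Set.range g))) (mP p)))) = n - r) :
    LinearIndependent k (fun l => gradAt p (g l)) := by
  set I := Ideal.span (Set.range g) with hI
  have hmem : ∀ x, Ideal.Quotient.mk I x ∈ Ideal.map (Ideal.Quotient.mk I) (mP p) ↔
      eval p x = 0 := fun x => by
    rw [← Ideal.mem_comap, Ideal.comap_map_mk hle]; exact RingHom.mem_ker
  obtain ⟨f, hfP, hf⟩ := exists_gens _ _ hd
  choose F hF using fun j => Ideal.Quotient.mk_surjective (I := I) (f j)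
  have hF0 : ∀ j, eval p (F j) = 0 := fun j => (hmem _).mp (by rw [hF]; exact hfP j)
  let G : Fin (n - r) ⊕ Fin r → MvPolynomial (Fin n) k := Sum.elim F g
  have hG : ∀ i, eval p (G i) = 0 := by
    rintro (i | i)
    · exact hF0 i
    · exact h0 i
  have hGspan : Ideal.span (Set.range G) = Ideal.span (Set.range F) ⊔ I := by
    rw [Set.Sum.elim_range, Ideal.span_union]
  have htop : ⊤ ≤ Submodule.span k (Set.range fun i => gradAt p (G i)) := by
    rw [← (Pi.basisFun k (Fin n)).span_eq]
    refine Submodule.span_le.mpr ?_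
    rintro _ ⟨i, rfl⟩
    obtain ⟨t, htP, ht⟩ := hf (Ideal.Quotient.mk I (X i - C (p i))) ((hmem _).mpr (by simp))
    obtain ⟨T, rfl⟩ := Ideal.Quotient.mk_surjective t
    rw [hmem] at htP
    have hfr : Set.range f = Ideal.Quotient.mk I '' Set.range F := by
      rw [← Set.range_comp]; congr 1; ext j; exact (hF j).symm
    rw [hfr, ← Ideal.map_span, ← map_mul, ← Ideal.mem_comap,
      Ideal.comap_map_of_surjective _ Ideal.Quotient.mk_surjective, ← RingHom.ker_eq_comap_bot,
      Ideal.mk_ker, ← hGspan] at ht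
    have h3 := (gradAt_mem_span p G hG _ ht).2
    have h4 : gradAt p (T * (X i - C (p i))) = eval p T • Pi.basisFun k (Fin n) i := by
      ext j
      by_cases hij : i = j
      · subst hij; simp [gradAt]
      · simp [gradAt, pderiv_X_of_ne hij, Pi.single_apply, Ne.symm hij]
    rw [h4] at h3
    exact (Submodule.smul_mem_iff _ htP).mp h3
  have hli := linearIndependent_of_top_le_span_of_card_eq_finrank htop (by simp; omega)
  exact hli.comp Sum.inr Sum.inr_injective

/-- If `W = V(g_1,…,g_r)` is a non-singular complete intersection of codimension `r` at every
point of `W ∩ D(g)`, then `g` lies in the radical of `I_W + M_r`, where `M_r` is generated by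
the `r × r` minors of the Jacobian matrix `(∂g_l/∂x_j)`: the complements of the vanishing loci
of these minors cover `W ∩ D(g)`. -/
theorem minors_cover_smooth_complete_intersection {k : Type} [Field k] [IsAlgClosed k]
    {n r : ℕ} (hr : r ≤ n) (g : Fin r → MvPolynomial (Fin n) k) (g0 : MvPolynomial (Fin n) k)
    (hreg : ∀ p : Fin n → k, ∀ h0 : (∀ l, eval p (g l) = 0), eval p g0 ≠ 0 →
      letI hle : Ideal.span (Set.range g) ≤ mP p :=
        Ideal.span_le.mpr (Set.range_subset_iff.mpr fun l => RingHom.mem_ker.mpr (h0 l))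
      letI := (qP_isMaximal p (Ideal.span (Set.range g)) hle).isPrime
      IsRegularLocal (Localization.AtPrime
          (Ideal.map (Ideal.Quotient.mk (Ideal.span (Set.range g))) (mP p))) ∧
        ringKrullDim (Localization.AtPrime
            (Ideal.map (Ideal.Quotient.mk (Ideal.span (Set.range g))) (mP p))) =
          ((n - r : ℕ) : WithBot ℕ∞)) :
    g0 ∈ (Ideal.span (Set.range g) +
        Ideal.span {d | ∃ S : Fin r ↪ Fin n,
          d = (Matrix.of fun a b : Fin r => pderiv (S b) (g a)).det}).radical := by
  classical
  have hae : ∀ (p : Fin n → k) (q : MvPolynomial (Fin n) k), aeval p q = eval p q :=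
    fun p q => by rw [← coe_aeval_eq_eval]; rfl
  rw [← vanishingIdeal_zeroLocus_eq_radical (K := k), mem_vanishingIdeal_iff]
  intro p hp
  rw [mem_zeroLocus_iff] at hp
  have h0 : ∀ l, eval p (g l) = 0 := fun l => by
    have := hp (g l) (Ideal.mem_sup_left (Ideal.subset_span ⟨l, rfl⟩))
    rwa [hae] at this
  rw [hae]
  by_contra hg
  obtain ⟨h1, h2⟩ := hreg p h0 hg
  have hle : Ideal.span (Set.range g) ≤ mP p :=
    Ideal.span_le.mpr (Set.range_subset_iff.mpr fun l => RingHom.mem_ker.mpr (h0 l))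
  have hP := (qP_isMaximal p (Ideal.span (Set.range g)) hle).isPrime
  have hli := jacobian_rows_independent hr g p h0 hle hP (by
    unfold IsRegularLocal at h1
    rw [h2] at h1
    exact_mod_cast h1.symm)
  obtain ⟨S, hS⟩ := exists_minor_ne_zero (Matrix.of fun l => gradAt p (g l)) hli
  apply hS
  have h5 := hp _ (Ideal.mem_sup_right (Ideal.subset_span ⟨S, rfl⟩))
  rw [hae, RingHom.map_det] at h5
  exact h5
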